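/- Let k be an algebraically closed field with char k ≠ 2, V a 7-dimensional k-vector space, γ a nondegenerate alternating trilinear form on V, and β a compatible nondegenerate symmetric bilinear form. Suppose V = L₁ ⊕ L₂ ⊕ ⋯ ⊕ L₇ is a direct sum of 1-dimensional subspaces such that some (equivalently any) nonzero u ∈ L₁ is γ-isotropic and L₁ ⊕ L₂ ⊕ L₃ = E_u = {v ∈ V : γ(u, v, x) = 0 for all x ∈ V}. Then for all nonzero v ∈ L₂ and nonzero w ∈ L₃, the vector γ(v, w, ·)† is a nonzero element of L₁; consequently the bilinear map (v, w) ↦ γ(v, w, ·)† induces a linear isomorphism L₂ ⊗ L₃ ≅ L₁. -/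

import Mathlib

open Module TensorProduct

section CrossProduct

variable {k V : Type*} [Field k] [AddCommGroup V] [Module k V]
  {β : V →ₗ[k] V →ₗ[k] k} {γ : V [⋀^Fin 3]→ₗ[k] k} {C : V →ₗ[k] V →ₗ[k] V}

/-- A nondegenerate form separates points. -/
theorem eq_of_forall_form_eq (hβnd : ∀ u : V, (∀ v : V, β u v = 0) → u = 0) {a b : V}
    (h : ∀ x, β a x = β b x) : a = b :=
  sub_eq_zero.1 <| hβnd _ fun x => by rw [map_sub, LinearMap.sub_apply, h, sub_self]

/-- If every functional `γ(u,v,·)` is represented by `β`, the representing vectors depend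
bilinearly on `u` and `v`. -/
theorem exists_crossProduct (hβnd : ∀ u : V, (∀ v : V, β u v = 0) → u = 0)
    (h : ∀ u v : V, ∃ d : V, ∀ x : V, β d x = γ ![u, v, x]) :
    ∃ C : V →ₗ[k] V →ₗ[k] V, ∀ u v x, β (C u v) x = γ ![u, v, x] := by
  choose c hc using h
  have hcurry : ∀ u v x, γ ![u, v, x] = (γ.curryLeft u).curryLeft v ![x] := fun _ _ _ => rfl
  refine ⟨LinearMap.mk₂ k c ?_ ?_ ?_ ?_, hc⟩ <;> intros <;>
    refine eq_of_forall_form_eq hβnd fun x => ?_ <;>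
    simp [hc, hcurry, AlternatingMap.curryLeft_add, AlternatingMap.curryLeft_smul,
      -AlternatingMap.curryLeft_apply_apply]

/-- The cross product is alternating. -/
theorem crossProduct_self (hβnd : ∀ u : V, (∀ v : V, β u v = 0) → u = 0)
    (hC : ∀ u v x, β (C u v) x = γ ![u, v, x]) (u : V) : C u u = 0 :=
  hβnd _ fun x => by
    rw [hC]
    exact γ.map_eq_zero_of_eq _ (i := 0) (j := 1) (by simp) (by decide)

/-- The cross product is antisymmetric. -/
theorem crossProduct_swap (hβnd : ∀ u : V, (∀ v : V, β u v = 0) → u = 0)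
    (hC : ∀ u v x, β (C u v) x = γ ![u, v, x]) (u v : V) : C v u = -C u v := by
  have h := crossProduct_self hβnd hC (u + v)
  simp only [map_add, LinearMap.add_apply, crossProduct_self hβnd hC] at h
  exact eq_neg_of_add_eq_zero_left (by simpa [add_comm] using h)

/-- Multiplication by `u` is skew-adjoint. -/
theorem form_crossProduct_swap (hC : ∀ u v x, β (C u v) x = γ ![u, v, x]) (u v x : V) :
    β (C u v) x = -β (C u x) v := by
  rw [hC, hC, ← γ.map_swap ![u, x, v] (i := 1) (j := 2) (by decide)]
  congr 1
  ext i
  fin_cases i <;> rfl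

/-- The square of multiplication by `u`. -/
theorem two_smul_crossProduct_crossProduct (hchar : (2 : k) ≠ 0)
    (hβsymm : ∀ u v : V, β u v = β v u)
    (hβnd : ∀ u : V, (∀ v : V, β u v = 0) → u = 0)
    (hC : ∀ u v x, β (C u v) x = γ ![u, v, x])
    (hQ : ∀ u v, 2 * β (C u v) (C u v) = β u u * β v v - (β u v) ^ 2) (u v : V) :
    (2 : k) • C u (C u v) = β u v • u - β u u • v := by
  refine eq_of_forall_form_eq hβnd fun x => ?_
  have h := hQ u (v + x)
  simp only [map_add, LinearMap.add_apply] at h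
  have hs := form_crossProduct_swap hC u (C u v) x
  simp only [map_smul, map_sub, LinearMap.smul_apply, LinearMap.sub_apply, smul_eq_mul, hs]
  apply mul_left_cancel₀ hchar
  rw [hβsymm (C u v) (C u x), hβsymm x v] at h
  linear_combination hQ u v + hQ u x - h

/-- Polarized form of the identity for the square of multiplication by `u`. -/
theorem two_smul_crossProduct_add (hchar : (2 : k) ≠ 0)
    (hβsymm : ∀ u v : V, β u v = β v u)
    (hβnd : ∀ u : V, (∀ v : V, β u v = 0) → u = 0)
    (hC : ∀ u v x, β (C u v) x = γ ![u, v, x])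
    (hQ : ∀ u v, 2 * β (C u v) (C u v) = β u u * β v v - (β u v) ^ 2) (a b x : V) :
    (2 : k) • (C a (C b x) + C b (C a x)) = β a x • b + β b x • a - (2 * β a b) • x := by
  have h := two_smul_crossProduct_crossProduct hchar hβsymm hβnd hC hQ
  have hab := h (a + b) x
  simp only [map_add, LinearMap.add_apply, hβsymm b a] at hab
  linear_combination (norm := module) hab - h a x - h b x

/-- The range of the skew-adjoint operator `C u` is the orthogonal complement of its kernel. -/
theorem mem_range_crossProduct [FiniteDimensional k V]
    (hβsymm : ∀ u v : V, β u v = β v u)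
    (hβnd : ∀ u : V, (∀ v : V, β u v = 0) → u = 0)
    (hC : ∀ u v x, β (C u v) x = γ ![u, v, x]) (u : V) {y : V}
    (hy : ∀ e, C u e = 0 → β y e = 0) : ∃ z, C u z = y := by
  have hrefl : LinearMap.IsRefl β := fun a b h => by rw [hβsymm, h]
  have hnd : LinearMap.BilinForm.Nondegenerate β :=
    hrefl.nondegenerate_iff_separatingLeft.2 hβnd
  have hle : LinearMap.range (C u) ≤
      LinearMap.BilinForm.orthogonal β (LinearMap.ker (C u)) := by
    rintro _ ⟨z, rfl⟩ e he
    change β e (C u z) = 0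
    rw [hβsymm, form_crossProduct_swap hC, LinearMap.mem_ker.1 he]
    simp
  have heq := Submodule.eq_of_le_of_finrank_eq hle <| by
    rw [LinearMap.BilinForm.finrank_orthogonal hnd]
    have := (C u).finrank_range_add_finrank_ker
    omega
  have hmem : y ∈ LinearMap.range (C u) := by
    rw [heq]
    intro e he
    change β e y = 0
    rw [hβsymm, hy e he]
  exact hmem

/-- If `u, v, w` are independent and span the annihilator of `u`, then `v × w` is a nonzero
multiple of `u`. -/
theorem crossProduct_eq_smul [FiniteDimensional k V] (hchar : (2 : k) ≠ 0)
    (hβsymm : ∀ u v : V, β u v = β v u)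
    (hβnd : ∀ u : V, (∀ v : V, β u v = 0) → u = 0)
    (hC : ∀ u v x, β (C u v) x = γ ![u, v, x])
    (hQ : ∀ u v, 2 * β (C u v) (C u v) = β u u * β v v - (β u v) ^ 2) {u v w : V}
    (hli : LinearIndependent k ![u, v, w]) (huv : C u v = 0) (huw : C u w = 0)
    (hspan : ∀ e, C u e = 0 → ∃ a b c : k, e = a • u + b • v + c • w) :
    C v w ≠ 0 ∧ ∃ a : k, C v w = a • u := by
  have hself := crossProduct_self hβnd hC
  have hswap := crossProduct_swap hβnd hC
  have hsq := two_smul_crossProduct_crossProduct hchar hβsymm hβnd hC hQ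
  have hpol := two_smul_crossProduct_add hchar hβsymm hβnd hC hQ
  have hu : u ≠ 0 := hli.ne_zero 0
  have hpair : ∀ s t : k, s • u + t • v = 0 → s = 0 ∧ t = 0 := fun s t h => by
    have h0 := Fintype.linearIndependent_iff.1 hli ![s, t, 0] (by simpa [Fin.sum_univ_three])
    exact ⟨h0 0, h0 1⟩
  have huu : β u u = 0 := by
    have h := hsq u v
    rw [huv, map_zero, smul_zero] at h
    have := (hpair (β u v) (-β u u) (by rw [h]; module)).2
    simpa using this
  have horth : ∀ e, C u e = 0 → β u e = 0 := fun e he => by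
    have h := hsq u e
    rw [he, map_zero, smul_zero, huu, zero_smul, sub_zero] at h
    exact (smul_eq_zero.1 h.symm).resolve_right hu
  have hmul : ∀ e f, C u e = 0 → C u f = 0 → (2 : k) • C u (C e f) = β e f • u := by
    intro e f he hf
    have h := hpol u e f
    rw [hf, horth e he, horth f hf] at h
    simpa using h
  have hnull : ∀ e f, C u e = 0 → C u f = 0 → β e f = 0 := by
    intro e f he hf
    have h₁ := hmul e f he hf
    have h₂ := hmul f e hf he
    rw [hswap e f, map_neg, hβsymm f e] at h₂
    have h : (2 * β e f) • u = 0 := by linear_combination (norm := module) -h₁ - h₂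
    exact (mul_eq_zero.1 ((smul_eq_zero.1 h).resolve_right hu)).resolve_left hchar
  have hd : C u (C v w) = 0 := by
    have h := hmul v w huv huw
    rw [hnull v w huv huw, zero_smul] at h
    exact (smul_eq_zero.1 h).resolve_left hchar
  have hvu : C v u = 0 := by rw [hswap u v, huv, neg_zero]
  have hne : C v w ≠ 0 := by
    intro hvw
    refine hu (hβnd u fun x => ?_)
    obtain ⟨z, hz⟩ := mem_range_crossProduct hβsymm hβnd hC u (y := C x v) fun e he => by
      obtain ⟨a, b, c, rfl⟩ := hspan e he
      rw [hswap v x, map_neg, LinearMap.neg_apply, form_crossProduct_swap hC]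
      simp [hvu, hself, hvw]
    have h₁ := hpol u x v
    have h₂ := hsq u z
    rw [huv, horth v huv, ← hz] at h₁
    rw [huu] at h₂
    simp only [map_zero, add_zero, zero_smul, zero_add, sub_zero] at h₁ h₂
    have h := (hpair (β u z - β x v) (2 * β u x) (by
      linear_combination (norm := module) h₁ - h₂)).2
    exact (mul_eq_zero.1 h).resolve_left hchar
  refine ⟨hne, ?_⟩
  have hvd : C v (C v w) = 0 := by
    have h := hsq v w
    rw [hnull v w huv huw, hnull v v huv huv] at h
    exact (smul_eq_zero.1 (by simpa using h)).resolve_left hchar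
  have hwd : C w (C v w) = 0 := by
    have h := hsq w v
    rw [hnull w v huw huv, hnull w w huw huw, hswap v w] at h
    exact (smul_eq_zero.1 (by simpa using h)).resolve_left hchar
  obtain ⟨a, b, c, habc⟩ := hspan _ hd
  have hc : c = 0 := by
    rw [habc] at hvd
    simp only [map_add, map_smul, hvu, hself, smul_zero, zero_add] at hvd
    exact (smul_eq_zero.1 hvd).resolve_right hne
  have hb : b = 0 := by
    rw [habc] at hwd
    simp only [map_add, map_smul, hself, hswap u w, huw, hswap v w, smul_zero, neg_zero, zero_add,
      add_zero, smul_neg] at hwd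
    exact (smul_eq_zero.1 (neg_eq_zero.1 hwd)).resolve_right hne
  exact ⟨a, by rw [habc, hb, hc]; module⟩

end CrossProduct

/-- Given a splitting `V = L₁ ⊕ ⋯ ⊕ L₇` into lines with `L₁` `γ`-isotropic
and `L₁ ⊕ L₂ ⊕ L₃ = E_u` for nonzero `u ∈ L₁`, the vector `γ(v,w,·)†` is a nonzero
element of `L₁` for all nonzero `v ∈ L₂`, `w ∈ L₃`; consequently `L₂ ⊗ L₃ ≅ L₁`. -/
theorem line_product_isomorphism
    {k : Type*} [Field k] [IsAlgClosed k] (hchar : (2 : k) ≠ 0)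
    {V : Type*} [AddCommGroup V] [Module k V] [FiniteDimensional k V]
    (hdim : finrank k V = 7)
    (β : V →ₗ[k] V →ₗ[k] k)
    (hβsymm : ∀ u v : V, β u v = β v u)
    (hβnd : ∀ u : V, (∀ v : V, β u v = 0) → u = 0)
    (γ : V [⋀^Fin 3]→ₗ[k] k)
    (hcompat : ∀ u v : V, ∃ d : V, (∀ x : V, β d x = γ ![u, v, x]) ∧
      2 * γ ![u, v, d] = β u u * β v v - (β u v) ^ 2)
    (L : Fin 7 → Submodule k V)
    (hL1 : ∀ i, finrank k (L i) = 1)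
    (hdirect : DirectSum.IsInternal L)
    (hiso : ∀ u ∈ L 0, u ≠ 0 →
      (∃ W : Submodule k V, finrank k W = 2 ∧
          (∀ a ∈ W, ∀ b ∈ W, ∀ x : V, γ ![a, b, x] = 0) ∧ u ∈ W) ∧
        ((L 0 ⊔ L 1 ⊔ L 2 : Submodule k V) : Set V) =
          {v : V | ∀ x : V, γ ![u, v, x] = 0}) :
    (∀ v ∈ L 1, v ≠ 0 → ∀ w ∈ L 2, w ≠ 0 →
        ∀ d : V, (∀ x : V, β d x = γ ![v, w, x]) → d ∈ L 0 ∧ d ≠ 0) ∧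
      Nonempty ((↥(L 1) ⊗[k] ↥(L 2)) ≃ₗ[k] ↥(L 0)) := by
  classical
  obtain ⟨C, hC⟩ := exists_crossProduct (γ := γ) hβnd fun u v =>
    (hcompat u v).imp fun _ h => h.1
  have hQ : ∀ u v, 2 * β (C u v) (C u v) = β u u * β v v - (β u v) ^ 2 := fun u v => by
    obtain ⟨d, hd, h⟩ := hcompat u v
    rw [← hd] at h
    rwa [eq_of_forall_form_eq hβnd fun x => (hC u v x).trans (hd x).symm]
  have hgen : ∀ i, ∀ x ∈ L i, x ≠ 0 → ∀ y ∈ L i, ∃ c : k, c • x = y := fun i x hx hx0 y hy => by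
    obtain ⟨c, hc⟩ := exists_smul_eq_of_finrank_eq_one (hL1 i) (x := ⟨x, hx⟩)
      (by simpa using hx0) ⟨y, hy⟩
    exact ⟨c, congrArg Subtype.val hc⟩
  refine ⟨fun v hv hv0 w hw hw0 d hd => ?_, ?_⟩
  · have hex : ∀ i, ∃ x ∈ L i, x ≠ 0 := fun i =>
      (L i).exists_mem_ne_zero_of_ne_bot fun h => by
        have := hL1 i
        rw [h, finrank_bot] at this
        exact zero_ne_one this
    choose e he he0 using hex
    have hli : LinearIndependent k ![e 0, v, w] := by
      have h := (hdirect.submodule_iSupIndep.linearIndependent L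
        (v := Function.update (Function.update e 1 v) 2 w) (fun i => by
          fin_cases i <;> simp [Function.update, he, hv, hw]) (fun i => by
          fin_cases i <;> simp [Function.update, he0, hv0, hw0])).comp ![0, 1, 2] (by decide)
      have heq : Function.update (Function.update e 1 v) 2 w ∘ ![0, 1, 2] = ![e 0, v, w] := by
        ext i
        fin_cases i <;> simp [Function.update]
      rwa [heq] at h
    have hE : ∀ x, x ∈ L 0 ⊔ L 1 ⊔ L 2 ↔ C (e 0) x = 0 := fun x => by
      rw [← SetLike.mem_coe, (hiso _ (he 0) (he0 0)).2]
      simp only [Set.mem_ofPred_eq, ← hC]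
      exact ⟨hβnd _, fun h y => by simp [h]⟩
    have hdC : d = C v w := eq_of_forall_form_eq hβnd fun x => (hd x).trans (hC v w x).symm
    obtain ⟨hne, a, ha⟩ := crossProduct_eq_smul hchar hβsymm hβnd hC hQ hli
      ((hE v).1 (Submodule.mem_sup_left (Submodule.mem_sup_right hv)))
      ((hE w).1 (Submodule.mem_sup_right hw)) fun x hx => by
        obtain ⟨y, hy, z, hz, rfl⟩ := Submodule.mem_sup.1 ((hE x).2 hx)
        obtain ⟨p, hp, q, hq, rfl⟩ := Submodule.mem_sup.1 hy
        obtain ⟨a, rfl⟩ := hgen 0 _ (he 0) (he0 0) p hp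
        obtain ⟨b, rfl⟩ := hgen 1 v hv hv0 q hq
        obtain ⟨c, rfl⟩ := hgen 2 w hw hw0 z hz
        exact ⟨a, b, c, rfl⟩
    exact ⟨by rw [hdC, ha]; exact (L 0).smul_mem a (he 0), hdC ▸ hne⟩
  · exact FiniteDimensional.nonempty_linearEquiv_of_finrank_eq (by
      rw [finrank_tensorProduct, hL1, hL1, hL1])
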